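/- Let t and p be positive integers with p ≥ 2, and let J = (V, E) be a weighted digraph with n = |V| and nonnegative weights satisfying Assumptions 1 and 2, with a distinguished source s having no incoming edges, and with indeg_J(v) ≤ p for every v ∈ V. Let Z_init ⊆ V with s ∈ Z_init. Then there exist a set Z with Z_init ⊆ Z ⊆ V and |Z \ Z_init| ≤ n(t+1)/p, and for each u ∈ V a finite set NL(u) of (vertex, nonnegative real) pairs with pairwise distinct vertices and pairwise distinct reals, such that: (i) (u, 0) ∈ NL(u) and |NL(u)| ≤ t + 1; (ii) each vertex of V appears in at most p² of the lists NL(u), u ∈ V; (iii) if (v, d) ∈ NL(u) then d is the weight of some path from u to v in J; and (iv) for every u ∈ V \ Z, writing NL(u) = {(v_0, d_0), …, (v_k, d_k)} with 0 = d_0 < d_1 < … < d_k: (a) if a vertex v is reachable from u in J − Z and v does not appear in NL(u), then k = t and d_t < dist_{J−Z}(u, v); and (b) d_i ≤ dist_{J−Z}(u, v_i) for all i = 0, …, k. -/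

import Mathlib

/-- A path from `s` to `t` in the digraph with edge set `E`: a finite sequence of edges
in which the head of each edge equals the tail of the next, starting at `s`, ending at `t`
(the empty sequence is a path from `s` to `s`). Paths need not be simple. -/
inductive IsPath {V : Type*} (E : Set (V × V)) : V → V → List (V × V) → Prop
  | nil (s : V) : IsPath E s s []
  | cons {s u t : V} {P : List (V × V)} :
      (s, u) ∈ E → IsPath E u t P → IsPath E s t ((s, u) :: P)

/-- The weight of a path: the sum of its edge weights. -/
def pweight {V : Type*} (w : V × V → ℝ) (P : List (V × V)) : ℝ :=
  (P.map w).sum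

/-- `distG E w u v` is the minimum weight of a path from `u` to `v`
(`+∞` if there is no such path). -/
noncomputable def distG {V : Type*} (E : Set (V × V)) (w : V × V → ℝ) (u v : V) : EReal :=
  sInf {r : EReal | ∃ P : List (V × V), IsPath E u v P ∧ r = (pweight w P : EReal)}

/-- `v` is reachable from `u`. -/
def Reach {V : Type*} (E : Set (V × V)) (u v : V) : Prop :=
  ∃ P : List (V × V), IsPath E u v P

/-- Assumption 1: every proper (contiguous) subpath of a path has strictly smaller weight. -/
def Assumption1 {V : Type*} (E : Set (V × V)) (w : V × V → ℝ) : Prop :=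
  ∀ (s t : V) (P : List (V × V)), IsPath E s t P →
    ∀ A P' B : List (V × V), P = A ++ P' ++ B → A ++ B ≠ [] →
      pweight w P' < pweight w P

/-- Assumption 2: for a fixed origin `u`, no two paths from `u` to distinct
targets have equal weight. -/
def Assumption2 {V : Type*} (E : Set (V × V)) (w : V × V → ℝ) : Prop :=
  ∀ (u x y : V) (P₁ P₂ : List (V × V)), IsPath E u x P₁ → IsPath E u y P₂ → x ≠ y →
    pweight w P₁ ≠ pweight w P₂

/-- The edge set of the subgraph induced on the complement of `Z` (the graph `G − Z`). -/
def ERemove {V : Type*} (E : Set (V × V)) (Z : Set V) : Set (V × V) :=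
  {e ∈ E | e.1 ∉ Z ∧ e.2 ∉ Z}

/-- `N` is the set of the `t` vertices distinct from `s` that are nearest to `s`
with respect to `distG` (or all vertices other than `s` reachable from `s`, if fewer
than `t` of them are reachable). -/
def IsNearSet {V : Type*} (E : Set (V × V)) (w : V × V → ℝ) (s : V) (t : ℕ)
    (N : Finset V) : Prop :=
  s ∉ N ∧ (∀ x ∈ N, Reach E s x) ∧
  (∀ x ∈ N, ∀ y : V, y ∉ N → y ≠ s → Reach E s y → distG E w s x ≤ distG E w s y) ∧
  (N.card = t ∨ (N.card < t ∧ ∀ y : V, y ≠ s → Reach E s y → y ∈ N))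

/-- `(a, b)` belongs to `E_t(a)`, i.e. it is among the `t` smallest-weight
outgoing edges of `a`. -/
def InTopT {V : Type*} (E : Set (V × V)) (w : V × V → ℝ) (t : ℕ) (a b : V) : Prop :=
  (a, b) ∈ E ∧ {c : V | (a, c) ∈ E ∧ w (a, c) < w (a, b)}.ncard < t

/-- `(E', w')` is obtained from `(E, w)` by contracting `X` into `s`:
its vertices avoid `X`; it keeps every edge of `E` avoiding `X`, and has an edge `s → v`
whenever some `x ∈ X` has an edge `x → v` with `v ∉ X`; among the resulting parallel
edges only one of smallest weight (`w (s, v)` itself, or `distG s x + w (x, v)`) is kept. -/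
def IsContraction {V : Type*} (E : Set (V × V)) (w : V × V → ℝ) (s : V) (X : Set V)
    (E' : Set (V × V)) (w' : V × V → ℝ) : Prop :=
  (∀ u v : V, ((u, v) ∈ E' ↔
      (u ∉ X ∧ v ∉ X ∧ ((u, v) ∈ E ∨ (u = s ∧ ∃ x ∈ X, (x, v) ∈ E))))) ∧
  (∀ u v : V, (u, v) ∈ E' → u ≠ s → w' (u, v) = w (u, v)) ∧
  (∀ v : V, (s, v) ∈ E' →
      ((w' (s, v) : EReal) =
        sInf {r : EReal | ((s, v) ∈ E ∧ r = (w (s, v) : EReal)) ∨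
          ∃ x ∈ X, (x, v) ∈ E ∧ r = distG E w s x + (w (x, v) : EReal)}))

theorem aux_nonneg {V : Type*} {F : Set (V × V)} {w : V × V → ℝ}
    (hw : ∀ e ∈ F, 0 ≤ w e) {u v : V} {P : List (V × V)} (h : IsPath F u v P) :
    0 ≤ pweight w P := by
  induction h with
  | nil s => simp [pweight]
  | cons he _ ih =>
    have := hw _ he
    simp only [pweight, List.map_cons, List.sum_cons] at *
    linarith

theorem aux_mono {V : Type*} {F E : Set (V × V)} (hFE : F ⊆ E) {u v : V}
    {P : List (V × V)} (h : IsPath F u v P) : IsPath E u v P := by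
  induction h with
  | nil s => exact IsPath.nil s
  | cons he _ ih => exact IsPath.cons (hFE he) ih

theorem aux_suffix {V : Type*} {F : Set (V × V)} {w : V × V → ℝ}
    (hw : ∀ e ∈ F, 0 ≤ w e) {u v : V} {P : List (V × V)} (h : IsPath F u v P)
    (x : V) (hx : x ∈ P.map Prod.fst) (hn : (P.map Prod.fst).Nodup) :
    ∃ Q, IsPath F x v Q ∧ pweight w Q ≤ pweight w P ∧ (Q.map Prod.fst).Nodup := by
  induction h with
  | nil s => simp at hx
  | @cons s y v P he hP ih =>
    by_cases hxs : x = s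
    · subst hxs
      exact ⟨_, IsPath.cons he hP, le_refl _, hn⟩
    · simp only [List.map_cons, List.mem_cons, hxs, false_or] at hx
      simp only [List.map_cons, List.nodup_cons] at hn
      obtain ⟨Q, h1, h2, h3⟩ := ih hx hn.2
      refine ⟨Q, h1, ?_, h3⟩
      have := hw _ he
      simp only [pweight, List.map_cons, List.sum_cons] at *
      linarith

theorem aux_simple {V : Type*} {F : Set (V × V)} {w : V × V → ℝ}
    (hw : ∀ e ∈ F, 0 ≤ w e) {u v : V} {P : List (V × V)} (h : IsPath F u v P) :
    ∃ Q, IsPath F u v Q ∧ pweight w Q ≤ pweight w P ∧ (Q.map Prod.fst).Nodup := by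
  induction h with
  | nil s => exact ⟨[], IsPath.nil s, le_refl _, by simp⟩
  | @cons s y v P he hP ih =>
    obtain ⟨Q, h1, h2, h3⟩ := ih
    have := hw _ he
    by_cases hs : s ∈ Q.map Prod.fst
    · obtain ⟨R, r1, r2, r3⟩ := aux_suffix hw h1 s hs h3
      refine ⟨R, r1, ?_, r3⟩
      simp only [pweight, List.map_cons, List.sum_cons] at *
      linarith
    · refine ⟨(s, y) :: Q, IsPath.cons he h1, ?_, ?_⟩
      · simp only [pweight, List.map_cons, List.sum_cons] at *
        linarith
      · simp only [List.map_cons, List.nodup_cons]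
        exact ⟨hs, h3⟩

theorem aux_min {V : Type*} [Fintype V] {F : Set (V × V)} {w : V × V → ℝ}
    (hw : ∀ e ∈ F, 0 ≤ w e) {u v : V} (h : Reach F u v) :
    ∃ P, IsPath F u v P ∧ ∀ Q, IsPath F u v Q → pweight w P ≤ pweight w Q := by
  classical
  have hfin : {l : List (V × V) | l.Nodup}.Finite := by
    have : Finite {l : List (V × V) // l.Nodup} := inferInstance
    exact Set.finite_coe_iff.1 this
  have hfin2 : {l : List (V × V) | IsPath F u v l ∧ l.Nodup}.Finite :=
    hfin.subset (fun l hl => hl.2)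
  obtain ⟨P, hP⟩ := h
  obtain ⟨P', h1, _, h3⟩ := aux_simple hw hP
  obtain ⟨R, hR, hmin⟩ := Set.exists_min_image _ (pweight w) hfin2
    ⟨P', h1, List.Nodup.of_map _ h3⟩
  refine ⟨R, hR.1, fun Q hQ => ?_⟩
  obtain ⟨Q', q1, q2, q3⟩ := aux_simple hw hQ
  exact (hmin Q' ⟨q1, List.Nodup.of_map _ q3⟩).trans q2

theorem aux_smallest {V : Type*} (R : Finset V) (f : V → ℝ)
    (hf : ∀ x ∈ R, ∀ y ∈ R, f x = f y → x = y) (k : ℕ) :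
    ∃ S ⊆ R, S.card ≤ k ∧ (∀ x ∈ S, ∀ y ∈ R, y ∉ S → f x < f y) ∧
      (∀ y ∈ R, y ∉ S → S.card = k) := by
  classical
  induction k with
  | zero => exact ⟨∅, by simp, by simp, by simp, by simp⟩
  | succ k ih =>
    obtain ⟨S, h1, h2, h3, h4⟩ := ih
    by_cases hne : (R \ S).Nonempty
    · obtain ⟨a, ha, hmin⟩ := Finset.exists_min_image (R \ S) f hne
      rw [Finset.mem_sdiff] at ha
      have hc := h4 a ha.1 ha.2
      have hc' : (insert a S).card = k + 1 := by
        rw [Finset.card_insert_of_notMem ha.2, hc]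
      refine ⟨insert a S, Finset.insert_subset ha.1 h1, hc'.le, ?_, fun _ _ _ => hc'⟩
      intro x hx y hy hyS
      rw [Finset.mem_insert, not_or] at hyS
      rcases Finset.mem_insert.1 hx with rfl | hx
      · refine lt_of_le_of_ne (hmin y (Finset.mem_sdiff.2 ⟨hy, hyS.2⟩)) ?_
        intro h
        exact hyS.1 (hf _ ha.1 _ hy h).symm
      · exact h3 x hx y hy hyS.2
    · rw [Finset.not_nonempty_iff_eq_empty, Finset.sdiff_eq_empty_iff_subset] at hne
      exact ⟨S, h1, by omega, h3, fun y hy hyS => absurd (hne hy) hyS⟩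

/-- `N` is the list of the `t+1` nearest vertices from `u` in `F`. -/
def GoodList {V : Type*} (F : Set (V × V)) (w : V × V → ℝ) (t : ℕ) (u : V)
    (N : Finset (V × ℝ)) : Prop :=
  (u, (0 : ℝ)) ∈ N ∧ N.card ≤ t + 1 ∧
  (∀ q ∈ N, 0 ≤ q.2) ∧
  (∀ (x : V) (d d' : ℝ), (x, d) ∈ N → (x, d') ∈ N → d = d') ∧
  (∀ q ∈ N, ∀ q' ∈ N, q.2 = q'.2 → q = q') ∧
  (∀ q ∈ N, ∃ P, IsPath F u q.1 P ∧ pweight w P = q.2) ∧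
  (∀ q ∈ N, ∀ P, IsPath F u q.1 P → q.2 ≤ pweight w P) ∧
  (∀ v P, (∀ d : ℝ, (v, d) ∉ N) → IsPath F u v P →
    N.card = t + 1 ∧ ∀ q ∈ N, q.2 < pweight w P)

theorem exists_goodList {V : Type*} [Fintype V] {F : Set (V × V)} {w : V × V → ℝ}
    (hw : ∀ e ∈ F, 0 ≤ w e) (hA2 : Assumption2 F w) (t : ℕ) (u : V) :
    ∃ N, GoodList F w t u N := by
  classical
  have key : ∀ v, ∃ d : ℝ, Reach F u v → (∃ P, IsPath F u v P ∧ pweight w P = d) ∧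
      ∀ Q, IsPath F u v Q → d ≤ pweight w Q := by
    intro v
    by_cases h : Reach F u v
    · obtain ⟨P, hP, hm⟩ := aux_min hw h
      exact ⟨pweight w P, fun _ => ⟨⟨P, hP, rfl⟩, hm⟩⟩
    · exact ⟨0, fun h' => absurd h' h⟩
  choose D hD using key
  have hD0 : ∀ v, Reach F u v → 0 ≤ D v := by
    intro v hv
    obtain ⟨⟨P, hP, h⟩, _⟩ := hD v hv
    rw [← h]; exact aux_nonneg hw hP
  have hru : Reach F u u := ⟨[], IsPath.nil u⟩
  have hDu : D u = 0 := by
    refine le_antisymm ?_ (hD0 u hru)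
    have := (hD u hru).2 [] (IsPath.nil u)
    simpa [pweight] using this
  have hinj : ∀ x, Reach F u x → ∀ y, Reach F u y → D x = D y → x = y := by
    intro x hx y hy hxy
    by_contra hne
    obtain ⟨⟨P, hP, h⟩, _⟩ := hD x hx
    obtain ⟨⟨Q, hQ, h'⟩, _⟩ := hD y hy
    exact hA2 u x y P Q hP hQ hne (by rw [h, h', hxy])
  obtain ⟨S, h1, h2, h3, h4⟩ := aux_smallest (Finset.univ.filter (fun v => Reach F u v)) D
    (by
      intro x hx y hy
      simp only [Finset.mem_filter, Finset.mem_univ, true_and] at hx hy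
      exact hinj x hx y hy) (t + 1)
  have hSR : ∀ x ∈ S, Reach F u x := by
    intro x hx
    have := h1 hx
    simpa using this
  have hcard : (S.image (fun x => (x, D x))).card = S.card := by
    apply Finset.card_image_of_injective
    intro a b h
    exact (Prod.mk.inj h).1
  have hmem : ∀ x d, (x, d) ∈ S.image (fun x => (x, D x)) ↔ x ∈ S ∧ D x = d := by
    intro x d
    simp only [Finset.mem_image, Prod.mk.injEq]
    constructor
    · rintro ⟨a, ha, rfl, rfl⟩; exact ⟨ha, rfl⟩
    · rintro ⟨ha, rfl⟩; exact ⟨x, ha, rfl, rfl⟩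
  refine ⟨S.image (fun x => (x, D x)), ?_, by rw [hcard]; exact h2, ?_, ?_, ?_, ?_, ?_, ?_⟩
  · rw [hmem]
    refine ⟨?_, hDu⟩
    by_contra hu
    have hc := h4 u (by simpa using hru) hu
    have : S.Nonempty := by rw [← Finset.card_pos]; omega
    obtain ⟨x, hx⟩ := this
    have := h3 x hx u (by simpa using hru) hu
    have := hD0 x (hSR x hx)
    linarith
  · rintro ⟨x, d⟩ hq
    rw [hmem] at hq
    rw [← hq.2]
    exact hD0 x (hSR x hq.1)
  · intro x d d' hx hx'
    rw [hmem] at hx hx'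
    rw [← hx.2, ← hx'.2]
  · rintro ⟨x, d⟩ hq ⟨y, d'⟩ hq' h
    rw [hmem] at hq hq'
    obtain ⟨a, rfl⟩ := hq
    obtain ⟨b, rfl⟩ := hq'
    have := hinj x (hSR x a) y (hSR y b) h
    subst this
    rfl
  · rintro ⟨x, d⟩ hq
    rw [hmem] at hq
    obtain ⟨a, rfl⟩ := hq
    exact (hD x (hSR x a)).1
  · rintro ⟨x, d⟩ hq
    rw [hmem] at hq
    obtain ⟨a, rfl⟩ := hq
    exact (hD x (hSR x a)).2
  · intro v P hv hP
    have hvS : v ∉ S := fun h => hv (D v) ((hmem _ _).2 ⟨h, rfl⟩)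
    have hvR : v ∈ Finset.univ.filter (fun v => Reach F u v) := by
      exact Finset.mem_filter.2 ⟨Finset.mem_univ _, P, hP⟩
    refine ⟨by rw [hcard]; exact h4 v hvR hvS, ?_⟩
    rintro ⟨x, d⟩ hq
    rw [hmem] at hq
    obtain ⟨a, rfl⟩ := hq
    exact lt_of_lt_of_le (h3 x a v hvR hvS) ((hD v ⟨P, hP⟩).2 P hP)

theorem aux_last {V : Type*} {F : Set (V × V)} {u v : V} {P : List (V × V)}
    (h : IsPath F u v P) :
    (P = [] ∧ u = v) ∨ ∃ y Q, IsPath F u y Q ∧ (y, v) ∈ F ∧ P = Q ++ [(y, v)] := by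
  induction h with
  | nil s => exact Or.inl ⟨rfl, rfl⟩
  | @cons s x v P he hP ih =>
    right
    rcases ih with ⟨rfl, rfl⟩ | ⟨y, Q, h1, h2, rfl⟩
    · exact ⟨s, [], IsPath.nil s, he, rfl⟩
    · exact ⟨y, (s, x) :: Q, IsPath.cons he h1, h2, rfl⟩

theorem GoodList.pred {V : Type*} {E F : Set (V × V)} {w : V × V → ℝ} (hFE : F ⊆ E)
    (hA1 : Assumption1 E w) {t : ℕ} {u : V} {N : Finset (V × ℝ)}
    (hN : GoodList F w t u N) {x : V} {d : ℝ} (hx : (x, d) ∈ N) (hne : u ≠ x) :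
    ∃ y, (y, x) ∈ F ∧ ∃ d', (y, d') ∈ N := by
  obtain ⟨_, _, _, _, _, h6, _, h8⟩ := hN
  obtain ⟨P, hP, hPd⟩ := h6 _ hx
  rcases aux_last hP with ⟨_, h⟩ | ⟨y, Q, h1, h2, h3⟩
  · exact absurd h hne
  · refine ⟨y, h2, ?_⟩
    by_contra hcon
    push Not at hcon
    have h := (h8 y Q hcon h1).2 _ hx
    have h' := hA1 u x P (aux_mono hFE hP) [] Q [(y, x)] (by simpa using h3) (by simp)
    rw [hPd] at h'
    exact lt_asymm h h'

/-- Sequential construction of the lists. -/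
theorem exists_lists {V : Type*} [Fintype V] {E : Set (V × V)} {w : V × V → ℝ}
    (hw : ∀ e ∈ E, 0 ≤ w e) (hA2 : Assumption2 E w) (t p : ℕ)
    (Zinit : Set V) (A : Finset V) :
    ∃ (NL : V → Finset (V × ℝ)) (B : V → Set V),
      (∀ u ∈ A, GoodList {e ∈ E | e.1 ∉ B u} w t u (NL u)) ∧
      (∀ u ∈ A, Zinit ⊆ B u) ∧
      (∀ x, {u | u ∈ A ∧ (∃ d, (x, d) ∈ NL u) ∧ x ∉ B u}.ncard ≤ p - 1) ∧
      (∀ u ∈ A, ∀ x, x ∈ B u → x ∉ Zinit → (∃ d, (x, d) ∈ NL u) →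
        p ≤ {u | u ∈ A ∧ (∃ d, (x, d) ∈ NL u)}.ncard) := by
  classical
  induction A using Finset.induction_on with
  | empty => exact ⟨fun _ => ∅, fun _ => ∅, by simp, by simp, by simp, by simp⟩
  | insert a A ha ih =>
    obtain ⟨NL, B, h1, h2, h3, h4⟩ := ih
    set Ba : Set V :=
      Zinit ∪ {x | p - 1 ≤ {u | u ∈ A ∧ (∃ d, (x, d) ∈ NL u)}.ncard} with hBa
    obtain ⟨N, hN⟩ := exists_goodList (F := {e ∈ E | e.1 ∉ Ba}) (w := w)
      (fun e he => hw e he.1)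
      (fun u x y P Q hP hQ => hA2 u x y P Q (aux_mono (fun e he => he.1) hP)
        (aux_mono (fun e he => he.1) hQ)) t a
    have hneq : ∀ u ∈ A, u ≠ a := fun u hu h => ha (h ▸ hu)
    have hNu : ∀ u ∈ A, Function.update NL a N u = NL u := fun u hu =>
      Function.update_of_ne (hneq u hu) _ _
    have hBu : ∀ u ∈ A, Function.update B a Ba u = B u := fun u hu =>
      Function.update_of_ne (hneq u hu) _ _
    have hsub : ∀ x, {u | u ∈ A ∧ (∃ d, (x, d) ∈ NL u)} ⊆
        {u | u ∈ insert a A ∧ (∃ d, (x, d) ∈ Function.update NL a N u)} := by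
      rintro x u ⟨hu, hd⟩
      exact ⟨Finset.mem_insert_of_mem hu, by rw [hNu u hu]; exact hd⟩
    refine ⟨Function.update NL a N, Function.update B a Ba, ?_, ?_, ?_, ?_⟩
    · intro u hu
      rcases Finset.mem_insert.1 hu with rfl | hu
      · simpa using hN
      · rw [hNu u hu, hBu u hu]; exact h1 u hu
    · intro u hu
      rcases Finset.mem_insert.1 hu with rfl | hu
      · simp [hBa]
      · rw [hBu u hu]; exact h2 u hu
    · intro x
      by_cases hx : x ∈ Ba
      · refine le_trans (Set.ncard_le_ncard ?_ (Set.toFinite _)) (h3 x)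
        rintro u ⟨hu, hd, hxB⟩
        rcases Finset.mem_insert.1 hu with rfl | hu
        · simp only [Function.update_self] at hxB
          exact absurd hx hxB
        · rw [hNu u hu] at hd
          rw [hBu u hu] at hxB
          exact ⟨hu, hd, hxB⟩
      · have hlt : {u | u ∈ A ∧ (∃ d, (x, d) ∈ NL u)}.ncard < p - 1 := by
          by_contra h
          exact hx (Or.inr (not_lt.1 h))
        have : {u | u ∈ insert a A ∧ (∃ d, (x, d) ∈ Function.update NL a N u) ∧
            x ∉ Function.update B a Ba u} ⊆
            insert a {u | u ∈ A ∧ (∃ d, (x, d) ∈ NL u)} := by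
          rintro u ⟨hu, hd, hxB⟩
          rcases Finset.mem_insert.1 hu with rfl | hu
          · exact Or.inl rfl
          · rw [hNu u hu] at hd
            exact Or.inr ⟨hu, hd⟩
        have := Set.ncard_le_ncard this (Set.toFinite _)
        have := Set.ncard_insert_le a {u | u ∈ A ∧ (∃ d, (x, d) ∈ NL u)}
        omega
    · intro u hu x hxB hxZ hd
      rcases Finset.mem_insert.1 hu with rfl | hu
      · simp only [Function.update_self] at hxB hd
        have hc : p - 1 ≤ {v | v ∈ A ∧ (∃ d, (x, d) ∈ NL v)}.ncard := by
          rcases hxB with h | h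
          · exact absurd h hxZ
          · exact h
        have hins : insert u {v | v ∈ A ∧ (∃ d, (x, d) ∈ NL v)} ⊆
            {v | v ∈ insert u A ∧ (∃ d, (x, d) ∈ Function.update NL u N v)} := by
          apply Set.insert_subset _ (hsub x)
          exact ⟨hu, by simpa using hd⟩
        have e1 := Set.ncard_le_ncard hins (Set.toFinite _)
        rw [Set.ncard_insert_of_notMem (fun h => ha h.1) (Set.toFinite _)] at e1
        omega
      · rw [hNu u hu] at hd
        rw [hBu u hu] at hxB
        exact (h4 u hu x hxB hxZ hd).trans (Set.ncard_le_ncard (hsub x) (Set.toFinite _))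

theorem aux_cut {V : Type*} {E : Set (V × V)} {w : V × V → ℝ}
    (hw : ∀ e ∈ E, 0 ≤ w e) (B Z : Set V) {u v : V} {P : List (V × V)}
    (h : IsPath (ERemove E Z) u v P) :
    ∃ y Q, IsPath {e ∈ E | e.1 ∉ B} u y Q ∧ pweight w Q ≤ pweight w P ∧
      (y = v ∨ (y ∈ B ∧ y ∉ Z)) := by
  have hw' : ∀ e ∈ ERemove E Z, 0 ≤ w e := fun e he => hw e he.1
  induction h with
  | nil s => exact ⟨s, [], IsPath.nil s, le_refl _, Or.inl rfl⟩
  | @cons s x v P he hP ih =>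
    by_cases hs : s ∈ B
    · refine ⟨s, [], IsPath.nil s, ?_, Or.inr ⟨hs, he.2.1⟩⟩
      have := aux_nonneg hw' (IsPath.cons he hP)
      simpa [pweight] using this
    · obtain ⟨y, Q, h1, h2, h3⟩ := ih
      refine ⟨y, (s, x) :: Q, IsPath.cons ⟨he.1, hs⟩ h1, ?_, h3⟩
      simp only [pweight, List.map_cons, List.sum_cons] at *
      linarith

/-- Existence of heavy vertices `Z ⊇ Z_init` with `|Z \ Z_init| ≤ n(t+1)/p` and near-lists
`NL(u)` satisfying properties (i)–(iv), for a digraph `J` with nonnegative weights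
satisfying Assumptions 1 and 2, source `s` without incoming edges, and in-degrees at
most `p`. -/
theorem stmt7 {V : Type*} [Fintype V]
    (E : Set (V × V)) (w : V × V → ℝ)
    (hw : ∀ e ∈ E, 0 ≤ w e)
    (hA1 : Assumption1 E w) (hA2 : Assumption2 E w)
    (s : V) (hs : ∀ u : V, (u, s) ∉ E)
    (t p : ℕ) (ht : 0 < t) (hp : 2 ≤ p)
    (hindeg : ∀ v : V, {u : V | (u, v) ∈ E}.ncard ≤ p)
    (Zinit : Set V) (hZs : s ∈ Zinit) :
    ∃ Z : Set V, Zinit ⊆ Z ∧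
      (((Z \ Zinit).ncard : ℝ) ≤ (Fintype.card V : ℝ) * ((t : ℝ) + 1) / (p : ℝ)) ∧
      ∃ NL : V → Finset (V × ℝ),
        -- (i) each near-list contains `(u, 0)` and at most `t` other vertices,
        -- with pairwise distinct vertices, pairwise distinct (nonnegative) distances
        (∀ u : V, (u, (0 : ℝ)) ∈ NL u ∧ (NL u).card ≤ t + 1 ∧
          (∀ q ∈ NL u, 0 ≤ q.2) ∧
          (∀ (x : V) (d d' : ℝ), (x, d) ∈ NL u → (x, d') ∈ NL u → d = d') ∧
          (∀ q ∈ NL u, ∀ q' ∈ NL u, q.2 = q'.2 → q = q')) ∧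
        -- (ii) each vertex appears in at most `p²` near-lists
        (∀ x : V, {u : V | ∃ d : ℝ, (x, d) ∈ NL u}.ncard ≤ p ^ 2) ∧
        -- (iii) every recorded distance is the weight of an actual path in `J`
        (∀ u : V, ∀ q ∈ NL u, ∃ P : List (V × V), IsPath E u q.1 P ∧ pweight w P = q.2) ∧
        -- (iv) domination properties (a) and (b) with respect to `J − Z`
        (∀ u : V, u ∉ Z →
          (∀ v : V, Reach (ERemove E Z) u v → (∀ d : ℝ, (v, d) ∉ NL u) →
            (NL u).card = t + 1 ∧
            ∀ q ∈ NL u, (q.2 : EReal) < distG (ERemove E Z) w u v) ∧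
          (∀ q ∈ NL u, (q.2 : EReal) ≤ distG (ERemove E Z) w u q.1)) := by

  classical
  obtain ⟨NL, B, h1, h2, h3, h4⟩ := exists_lists hw hA2 t p Zinit Finset.univ
  simp only [Finset.mem_univ, true_and, forall_true_left] at h1 h2 h3 h4
  have hsubE : ∀ u, {e ∈ E | e.1 ∉ B u} ⊆ E := fun u e he => he.1
  set H : Set V := {x | p ≤ {u | ∃ d : ℝ, (x, d) ∈ NL u}.ncard} with hH
  have hcut : ∀ u v P, IsPath (ERemove E (Zinit ∪ H)) u v P →
      (IsPath (ERemove E (Zinit ∪ H)) u v P ∧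
        ∃ Q, IsPath {e ∈ E | e.1 ∉ B u} u v Q ∧ pweight w Q ≤ pweight w P) ∨
      ((NL u).card = t + 1 ∧ ∀ q ∈ NL u, q.2 < pweight w P) := by
    intro u v P hP
    obtain ⟨y, Q, c1, c2, c3⟩ := aux_cut hw (B u) (Zinit ∪ H) hP
    rcases c3 with rfl | ⟨hyB, hyZ⟩
    · exact Or.inl ⟨hP, Q, c1, c2⟩
    · right
      rw [Set.mem_union, not_or] at hyZ
      have hyN : ∀ d : ℝ, (y, d) ∉ NL u := by
        intro d hd
        exact hyZ.2 (h4 u y hyB hyZ.1 ⟨d, hd⟩)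
      obtain ⟨_, _, _, _, _, _, _, g8⟩ := h1 u
      obtain ⟨k1, k2⟩ := g8 y Q hyN c1
      exact ⟨k1, fun q hq => (k2 q hq).trans_le c2⟩
  refine ⟨Zinit ∪ H, Set.subset_union_left, ?_, NL, ?_, ?_, ?_, ?_⟩
  · have hp0 : (0 : ℝ) < p := by exact_mod_cast (by omega : 0 < p)
    rw [le_div_iff₀ hp0]
    have hle : ((Zinit ∪ H) \ Zinit).ncard ≤ H.ncard :=
      Set.ncard_le_ncard (by
        rintro x ⟨hx | hx, hx'⟩
        · exact absurd hx hx'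
        · exact hx) (Set.toFinite _)
    have hcount : H.ncard * p ≤ Fintype.card V * (t + 1) := by
      have hdc := Finset.sum_card_bipartiteAbove_eq_sum_card_bipartiteBelow
        (s := (Finset.univ : Finset V)) (t := (Finset.univ : Finset V))
        (fun x u => ∃ d : ℝ, (x, d) ∈ NL u)
      have hl : H.ncard * p ≤ ∑ x : V, (Finset.bipartiteAbove
          (fun x u => ∃ d : ℝ, (x, d) ∈ NL u) Finset.univ x).card := by
        rw [Set.ncard_eq_toFinset_card' H, ← smul_eq_mul]
        refine le_trans (Finset.card_nsmul_le_sum H.toFinset _ p ?_)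
          (Finset.sum_le_sum_of_subset (Finset.subset_univ _))
        intro x hx
        rw [Set.mem_toFinset] at hx
        have hx' : p ≤ {u | ∃ d : ℝ, (x, d) ∈ NL u}.ncard := hx
        rw [Set.ncard_eq_toFinset_card'] at hx'
        refine hx'.trans (Finset.card_le_card ?_)
        intro u hu
        simpa [Finset.bipartiteAbove] using hu
      have hr : ∑ u : V, (Finset.bipartiteBelow
          (fun x u => ∃ d : ℝ, (x, d) ∈ NL u) Finset.univ u).card ≤
          Fintype.card V * (t + 1) := by
        have := Finset.sum_le_card_nsmul (Finset.univ : Finset V) (fun u =>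
          (Finset.bipartiteBelow (fun x u => ∃ d : ℝ, (x, d) ∈ NL u) Finset.univ u).card)
          (t + 1) (by
            intro u _
            refine le_trans ?_ (h1 u).2.1
            refine le_trans (Finset.card_le_card (t := (NL u).image Prod.fst) ?_)
              Finset.card_image_le
            intro x hx
            simpa [Finset.bipartiteBelow] using hx)
        simpa using this
      omega
    have : ((Zinit ∪ H) \ Zinit).ncard * p ≤ Fintype.card V * (t + 1) :=
      (Nat.mul_le_mul_right p hle).trans hcount
    exact_mod_cast this
  · intro u
    obtain ⟨g1, g2, g3, g4, g5, _⟩ := h1 u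
    exact ⟨g1, g2, g3, g4, g5⟩
  · intro x
    set I : Finset V := {u : V | (u, x) ∈ E}.toFinset with hI
    have hIc : I.card ≤ p := by
      rw [hI, ← Set.ncard_eq_toFinset_card']; exact hindeg x
    set T : V → Finset V := fun y => {u | (∃ d : ℝ, (y, d) ∈ NL u) ∧ y ∉ B u}.toFinset with hT
    have hTc : ∀ y ∈ I, (T y).card ≤ p - 1 := by
      intro y _
      rw [hT, ← Set.ncard_eq_toFinset_card']; exact h3 y
    have hb := Finset.card_biUnion_le_card_mul I T (p - 1) hTc
    have hsub : {u : V | ∃ d : ℝ, (x, d) ∈ NL u} ⊆ ↑(insert x (I.biUnion T)) := by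
      rintro u ⟨d, hd⟩
      by_cases hux : u = x
      · subst hux; simp
      · obtain ⟨y, hy, hyd⟩ := (h1 u).pred (hsubE u) hA1 hd hux
        rw [Finset.mem_coe, Finset.mem_insert, Finset.mem_biUnion]
        refine Or.inr ⟨y, ?_, ?_⟩
        · rw [hI, Set.mem_toFinset]; exact hy.1
        · rw [hT, Set.mem_toFinset]; exact ⟨hyd, hy.2⟩
    have hn := Set.ncard_le_ncard hsub (Set.toFinite _)
    rw [Set.ncard_coe_finset] at hn
    have hi := Finset.card_insert_le x (I.biUnion T)
    have hm : I.card * (p - 1) ≤ p * (p - 1) := Nat.mul_le_mul_right _ hIc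
    have hpp : p * (p - 1) + 1 ≤ p ^ 2 := by
      obtain ⟨k, rfl⟩ : ∃ k, p = k + 1 := ⟨p - 1, by omega⟩
      simp only [Nat.add_sub_cancel]
      nlinarith
    omega
  · intro u q hq
    obtain ⟨_, _, _, _, _, g6, _⟩ := h1 u
    obtain ⟨P, hP, hd⟩ := g6 q hq
    exact ⟨P, aux_mono (hsubE u) hP, hd⟩
  · intro u _
    obtain ⟨_, _, _, _, _, _, g7, g8⟩ := h1 u
    refine ⟨?_, ?_⟩
    · intro v hv hvN
      obtain ⟨P, hP, hmin⟩ := aux_min (w := w)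
        (fun e (he : e ∈ ERemove E (Zinit ∪ H)) => hw e he.1) hv
      have hres : (NL u).card = t + 1 ∧ ∀ q ∈ NL u, q.2 < pweight w P := by
        rcases hcut u v P hP with ⟨_, Q, hQ, hle⟩ | h
        · obtain ⟨k1, k2⟩ := g8 v Q hvN hQ
          exact ⟨k1, fun q hq => (k2 q hq).trans_le hle⟩
        · exact h
      refine ⟨hres.1, fun q hq => ?_⟩
      refine lt_of_lt_of_le (EReal.coe_lt_coe_iff.2 (hres.2 q hq)) ?_
      apply le_sInf
      rintro r ⟨Q, hQ, rfl⟩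
      exact EReal.coe_le_coe_iff.2 (hmin Q hQ)
    · intro q hq
      apply le_sInf
      rintro r ⟨P, hP, rfl⟩
      rw [EReal.coe_le_coe_iff]
      rcases hcut u q.1 P hP with ⟨_, Q, hQ, hle⟩ | h
      · exact (g7 q hq Q hQ).trans hle
      · exact (h.2 q hq).le
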